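/- Let A = (α_{ij}) = (a_{ij} + A_{ij}) be an n×n triangular matrix over 𝔼 (upper triangular: α_{ij} is a neutrix whenever j < i; lower triangular: α_{ij} is a neutrix whenever i < j) such that ᾱ = max_{i,j} |α_{ij}| is zeroless. If A is reduced, then det(A) ⊆ α_{11}α_{22}⋯α_{nn} + Ā. In general, det(A) ⊆ α_{11}α_{22}⋯α_{nn} + ᾱ^{n−1}·Ā. Consequently, if ᾱ^{n−1}·Ā ⊆ N(α_{11}α_{22}⋯α_{nn}), then det(A) = α_{11}α_{22}⋯α_{nn}. -/

import Mathlib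

open scoped Pointwise Classical

noncomputable section

-- Note: `ℝ*` is Mathlib's notation for the hyperreals `Hyperreal`.

/-- A neutrix: an order-convex additive subgroup of the hyperreals. -/
def IsNeutrix (A : Set ℝ*) : Prop :=
  (0 : ℝ*) ∈ A ∧ (∀ x ∈ A, ∀ y ∈ A, x + y ∈ A) ∧ (∀ x ∈ A, -x ∈ A) ∧
    ∀ x ∈ A, ∀ y ∈ A, ∀ z : ℝ*, x ≤ z → z ≤ y → z ∈ A

/-- The coset `a + A`. -/
def coset (a : ℝ*) (A : Set ℝ*) : Set ℝ* := {x | ∃ u ∈ A, x = a + u}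

/-- `α` is an external number: a coset of a neutrix. -/
def IsExt (α : Set ℝ*) : Prop := ∃ a A, IsNeutrix A ∧ α = coset a A

/-- The neutrix part `N(α)` of an external number, as the set of differences. -/
def Nx (α : Set ℝ*) : Set ℝ* := {d | ∃ x ∈ α, ∃ y ∈ α, d = x - y}

/-- An external number is zeroless if it does not contain `0`. -/
def Zeroless (α : Set ℝ*) : Prop := (0 : ℝ*) ∉ α

/-- Multiplication of external numbers: `αβ = ab + aB + bA + AB`
(independent of the chosen representatives). -/
def emul (α β : Set ℝ*) : Set ℝ* :=
  {z | ∃ a A b B, IsNeutrix A ∧ IsNeutrix B ∧ α = coset a A ∧ β = coset b B ∧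
      ∃ u ∈ A, ∃ v ∈ B, ∃ u' ∈ A, ∃ v' ∈ B, z = a * b + a * v + b * u + u' * v'}

/-- Multiplication of an external number by a hyperreal scalar: `t·α = ta + tA`. -/
def esmul (t : ℝ*) (α : Set ℝ*) : Set ℝ* := (fun x => t * x) '' α

/-- Inverse of a (zeroless) external number: `1/α = 1/a + A/a²`. -/
def einv (α : Set ℝ*) : Set ℝ* :=
  {z | ∃ a A, IsNeutrix A ∧ α = coset a A ∧ ∃ u ∈ A, z = a⁻¹ + u / a ^ 2}

/-- Division of external numbers: `α/β = α · (1/β)`. -/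
def ediv (α β : Set ℝ*) : Set ℝ* := emul α (einv β)

/-- The neutrix `⊘` of infinitesimal hyperreals. -/
def oslash : Set ℝ* := {x | Hyperreal.Infinitesimal x}

/-- Relative uncertainty `R(α)`: `A/a` if `α = a + A` is zeroless,
and all of `ℝ*` if `α` is a neutrix. -/
def RU (α : Set ℝ*) : Set ℝ* :=
  if (0 : ℝ*) ∈ α then Set.univ
  else {z | ∃ a A, IsNeutrix A ∧ α = coset a A ∧ ∃ u ∈ A, z = u / a}

/-- `α` and `β` are nearly opposite: both zeroless and `α/β ⊆ -1 + ⊘`. -/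
def NearlyOpposite (α β : Set ℝ*) : Prop :=
  Zeroless α ∧ Zeroless β ∧ ediv α β ⊆ coset (-1) oslash

/-- Order on external numbers: `α ≤ β` iff `∀ x ∈ α, ∃ y ∈ β, x ≤ y`. -/
def ele (α β : Set ℝ*) : Prop := ∀ x ∈ α, ∃ y ∈ β, x ≤ y

/-- `α` is non-negative: some element of `α` is `≥ 0`. -/
def eNonneg (α : Set ℝ*) : Prop := ∃ x ∈ α, (0 : ℝ*) ≤ x

/-- Absolute value of an external number: `|α| = |a| + A`. -/
def eabs (α : Set ℝ*) : Set ℝ* :=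
  {z | ∃ a A, IsNeutrix A ∧ α = coset a A ∧ ∃ u ∈ A, z = |a| + u}

/-- Product of a finite family of external numbers. -/
def eprod : ∀ {n : ℕ}, (Fin n → Set ℝ*) → Set ℝ*
  | 0, _ => {1}
  | _ + 1, f => emul (f 0) (eprod fun i => f i.succ)

/-- Power of an external number. -/
def epow (α : Set ℝ*) : ℕ → Set ℝ*
  | 0 => {1}
  | k + 1 => emul α (epow α k)

/-- Matrix product over external numbers: `(AB)_{ij} = Σ_k α_{ik}β_{kj}`. -/
def matMul {m n p : ℕ} (M : Matrix (Fin m) (Fin n) (Set ℝ*))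
    (N : Matrix (Fin n) (Fin p) (Set ℝ*)) : Matrix (Fin m) (Fin p) (Set ℝ*) :=
  fun i j => ∑ k, emul (M i k) (N k j)

/-- Entrywise (Minkowski) sum of matrices over external numbers. -/
def matAdd {m n : ℕ} (M N : Matrix (Fin m) (Fin n) (Set ℝ*)) :
    Matrix (Fin m) (Fin n) (Set ℝ*) := fun i j => M i j + N i j

/-- Entrywise scalar multiple of a matrix by an external number. -/
def matSmul {m n : ℕ} (α : Set ℝ*) (M : Matrix (Fin m) (Fin n) (Set ℝ*)) :
    Matrix (Fin m) (Fin n) (Set ℝ*) := fun i j => emul α (M i j)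

/-- Entrywise inclusion of matrices over external numbers. -/
def matIncl {m n : ℕ} (M N : Matrix (Fin m) (Fin n) (Set ℝ*)) : Prop :=
  ∀ i j, M i j ⊆ N i j

/-- Determinant of a square matrix over the external numbers. -/
def detE {n : ℕ} (M : Matrix (Fin n) (Fin n) (Set ℝ*)) : Set ℝ* :=
  ∑ σ : Equiv.Perm (Fin n),
    esmul ((Equiv.Perm.sign σ : ℤ) : ℝ*) (eprod fun i => M i (σ i))

/-- The `(i,j)` minor of a square matrix over the external numbers. -/
def minorE {n : ℕ} (M : Matrix (Fin (n + 1)) (Fin (n + 1)) (Set ℝ*))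
    (i j : Fin (n + 1)) : Set ℝ* :=
  detE (M.submatrix i.succAbove j.succAbove)

/-- The near-identity matrix `I_n(N)`: diagonal entries `1 + N`, off-diagonal entries `N`. -/
def Iun (n : ℕ) (N : Set ℝ*) : Matrix (Fin n) (Fin n) (Set ℝ*) :=
  fun i j => if i = j then coset 1 N else N

/-- A finite family of vectors of external numbers is linearly dependent:
some nontrivial real (hyperreal) linear combination is a neutrix vector. -/
def LinDepE {ι : Type*} [Fintype ι] {n : ℕ} (ξ : ι → Fin n → Set ℝ*) : Prop :=
  ∃ t : ι → ℝ*, (∃ i, t i ≠ 0) ∧ ∃ A : Fin n → Set ℝ*,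
    (∀ j, IsNeutrix (A j)) ∧ ∀ j, (∑ i, esmul (t i) (ξ i j)) = A j

/-- The matrix has a zeroless minor of order `k`. -/
def HasZerolessMinor {m n : ℕ} (M : Matrix (Fin m) (Fin n) (Set ℝ*)) (k : ℕ) : Prop :=
  ∃ (f : Fin k → Fin m) (g : Fin k → Fin n), Function.Injective f ∧ Function.Injective g ∧
    Zeroless (detE fun i j => M (f i) (g j))

/-- The minor rank of `M` is `r`. -/
def minorRankIs {m n : ℕ} (M : Matrix (Fin m) (Fin n) (Set ℝ*)) (r : ℕ) : Prop :=
  HasZerolessMinor M r ∧ ∀ k, HasZerolessMinor M k → k ≤ r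

/-- The row rank of `M` is `r`: the maximal cardinality of a linearly
independent set of row vectors of `M` is `r`. -/
def rowRankIs {m n : ℕ} (M : Matrix (Fin m) (Fin n) (Set ℝ*)) (r : ℕ) : Prop :=
  (∃ s : Finset (Fin m), s.card = r ∧ ¬ LinDepE fun (i : {x // x ∈ s}) j => M i.1 j) ∧
  ∀ s : Finset (Fin m), (¬ LinDepE fun (i : {x // x ∈ s}) j => M i.1 j) → s.card ≤ r

/-- `M` is a reduced matrix: `max_{i,j} |α_{ij}| = 1 + A₀` for some neutrix `A₀ ⊆ ⊘`. -/
def IsReducedMat {m n : ℕ} (M : Matrix (Fin m) (Fin n) (Set ℝ*)) : Prop :=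
  ∃ A₀, IsNeutrix A₀ ∧ A₀ ⊆ oslash ∧ (∃ i j, eabs (M i j) = coset 1 A₀) ∧
    ∀ i j, ele (eabs (M i j)) (coset 1 A₀)

namespace IsNeutrix

variable {A B : Set ℝ*}

lemma zero_mem (hA : IsNeutrix A) : (0 : ℝ*) ∈ A := hA.1

lemma add_mem (hA : IsNeutrix A) {x y : ℝ*} (hx : x ∈ A) (hy : y ∈ A) : x + y ∈ A :=
  hA.2.1 x hx y hy

lemma neg_mem (hA : IsNeutrix A) {x : ℝ*} (hx : x ∈ A) : -x ∈ A := hA.2.2.1 x hx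

lemma sub_mem (hA : IsNeutrix A) {x y : ℝ*} (hx : x ∈ A) (hy : y ∈ A) : x - y ∈ A := by
  rw [sub_eq_add_neg]; exact hA.add_mem hx (hA.neg_mem hy)

lemma abs_mem (hA : IsNeutrix A) {x : ℝ*} (hx : x ∈ A) : |x| ∈ A := by
  rcases abs_choice x with h | h <;> rw [h]
  exacts [hx, hA.neg_mem hx]

lemma mem_of_abs_le (hA : IsNeutrix A) {x y : ℝ*} (hx : x ∈ A) (h : |y| ≤ |x|) : y ∈ A :=
  hA.2.2.2 (-|x|) (hA.neg_mem (hA.abs_mem hx)) |x| (hA.abs_mem hx) y (abs_le.1 h).1 (abs_le.1 h).2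

lemma of_abs_le (h0 : (0 : ℝ*) ∈ A) (hadd : ∀ x ∈ A, ∀ y ∈ A, x + y ∈ A)
    (hle : ∀ x ∈ A, ∀ y : ℝ*, |y| ≤ |x| → y ∈ A) : IsNeutrix A := by
  refine ⟨h0, hadd, fun x hx => hle x hx _ (abs_neg x).le, fun x hx y hy z hxz hzy => ?_⟩
  rcases le_total 0 z with hz | hz
  · exact hle y hy z (abs_le_abs hzy (by linarith))
  · exact hle x hx z (abs_le_abs_of_nonpos hz hxz)

lemma natCast_mul_mem (hA : IsNeutrix A) (m : ℕ) {x : ℝ*} (hx : x ∈ A) : (m : ℝ*) * x ∈ A := by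
  induction m with
  | zero => simpa using hA.zero_mem
  | succ k ih =>
    have h := hA.add_mem ih hx
    rwa [Nat.cast_succ, add_mul, one_mul]

lemma smul (hA : IsNeutrix A) (t : ℝ*) : IsNeutrix (t • A) := by
  refine of_abs_le ⟨0, hA.zero_mem, by simp⟩ ?_ ?_
  · rintro _ ⟨x, hx, rfl⟩ _ ⟨y, hy, rfl⟩
    exact ⟨x + y, hA.add_mem hx hy, by simp [mul_add]⟩
  · rintro _ ⟨x, hx, rfl⟩ y h
    rcases eq_or_ne t 0 with rfl | ht
    · exact ⟨0, hA.zero_mem, by simp at h; simp [h]⟩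
    · refine ⟨y / t, hA.mem_of_abs_le hx ?_, by simp only [smul_eq_mul]; field_simp⟩
      simp only [smul_eq_mul, abs_mul] at h
      rw [abs_div, div_le_iff₀ (abs_pos.2 ht)]
      linarith

lemma add (hA : IsNeutrix A) (hB : IsNeutrix B) : IsNeutrix (A + B) := by
  refine of_abs_le ⟨0, hA.zero_mem, 0, hB.zero_mem, by simp⟩ ?_ ?_
  · rintro _ ⟨x, hx, y, hy, rfl⟩ _ ⟨x', hx', y', hy', rfl⟩
    exact ⟨x + x', hA.add_mem hx hx', y + y', hB.add_mem hy hy', by simp only []; ring⟩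
  · rintro _ ⟨x, hx, y, hy, rfl⟩ w h
    have hw : |w| ≤ |x| + |y| := h.trans (abs_add_le x y)
    rcases le_total |x| |y| with hxy | hxy
    · refine ⟨0, hA.zero_mem, w, hB.mem_of_abs_le (hB.add_mem hy hy) ?_, by simp⟩
      rw [← two_mul, abs_mul, abs_two]; linarith
    · refine ⟨w, hA.mem_of_abs_le (hA.add_mem hx hx) ?_, 0, hB.zero_mem, by simp⟩
      rw [← two_mul, abs_mul, abs_two]; linarith

lemma mul (hA : IsNeutrix A) (hB : IsNeutrix B) : IsNeutrix (A * B) := by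
  have hle : ∀ u ∈ A, ∀ v ∈ B, ∀ w : ℝ*, |w| ≤ |u * v| → w ∈ A * B := by
    intro u hu v hv w h
    rcases eq_or_ne v 0 with rfl | hv0
    · exact ⟨0, hA.zero_mem, 0, hB.zero_mem, by simp at h; simp [h]⟩
    · refine ⟨w / v, hA.mem_of_abs_le hu ?_, v, hv, by simp only []; field_simp⟩
      rwa [abs_div, div_le_iff₀ (abs_pos.2 hv0), ← abs_mul]
  refine of_abs_le ⟨0, hA.zero_mem, 0, hB.zero_mem, by simp⟩ ?_ ?_
  · rintro _ ⟨u, hu, v, hv, rfl⟩ _ ⟨u', hu', v', hv', rfl⟩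
    refine hle (|u| + |u'|) (hA.add_mem (hA.abs_mem hu) (hA.abs_mem hu')) (|v| + |v'|)
      (hB.add_mem (hB.abs_mem hv) (hB.abs_mem hv')) _ ?_
    have h1 := abs_add_le (u * v) (u' * v')
    rw [abs_mul, abs_mul] at h1
    rw [abs_of_nonneg (a := (|u| + |u'|) * (|v| + |v'|)) (by positivity)]
    have h2 : 0 ≤ |u| * |v'| := by positivity
    have h3 : 0 ≤ |u'| * |v| := by positivity
    simp only []
    linarith
  · rintro _ ⟨u, hu, v, hv, rfl⟩ w h
    exact hle u hu v hv w h

lemma finsetSum_subset {ι : Type*} (hA : IsNeutrix A) (s : Finset ι) (F : ι → Set ℝ*)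
    (hF : ∀ i ∈ s, F i ⊆ A) : ∑ i ∈ s, F i ⊆ A := by
  induction s using Finset.cons_induction with
  | empty =>
    rintro x hx
    rw [Finset.sum_empty] at hx
    rw [Set.mem_zero.1 hx]
    exact hA.zero_mem
  | cons i s hi ih =>
    rw [Finset.sum_cons]
    rintro _ ⟨x, hx, y, hy, rfl⟩
    exact hA.add_mem (hF i (Finset.mem_cons_self i s) hx)
      (ih (fun j hj => hF j (Finset.mem_cons_of_mem hj)) hy)

end IsNeutrix

lemma Nx_coset {A : Set ℝ*} (hA : IsNeutrix A) (a : ℝ*) : Nx (coset a A) = A := by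
  ext d
  constructor
  · rintro ⟨_, ⟨u, hu, rfl⟩, _, ⟨v, hv, rfl⟩, rfl⟩
    rw [add_sub_add_left_eq_sub]
    exact hA.sub_mem hu hv
  · intro hd
    exact ⟨a + d, ⟨d, hd, rfl⟩, a, ⟨0, hA.zero_mem, by simp⟩, by ring⟩

lemma mem_coset_self {A : Set ℝ*} (hA : IsNeutrix A) (a : ℝ*) : a ∈ coset a A :=
  ⟨0, hA.zero_mem, by simp⟩

lemma coset_zero (A : Set ℝ*) : coset 0 A = A := by
  ext; simp [coset]

lemma isNeutrix_singleton_zero : IsNeutrix ({0} : Set ℝ*) := by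
  refine IsNeutrix.of_abs_le rfl ?_ ?_ <;> simp

lemma coset_singleton_zero (a : ℝ*) : coset a {0} = {a} := by
  ext; simp [coset]

/-- Two representations of the same external number have the same neutrix part, and their
representatives differ by an element of it. -/
lemma coset_eq_coset {a b : ℝ*} {A B : Set ℝ*} (hA : IsNeutrix A) (hB : IsNeutrix B)
    (h : coset a A = coset b B) : B = A ∧ ∃ u ∈ A, b = a + u := by
  refine ⟨by rw [← Nx_coset hB b, ← h, Nx_coset hA], ?_⟩
  have hb : b ∈ coset a A := h ▸ mem_coset_self hB b
  exact hb

lemma IsExt.nonempty {α : Set ℝ*} (hα : IsExt α) : α.Nonempty := by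
  obtain ⟨a, A, hA, rfl⟩ := hα
  exact ⟨a, mem_coset_self hA a⟩

lemma IsExt.isNeutrix_Nx {α : Set ℝ*} (hα : IsExt α) : IsNeutrix (Nx α) := by
  obtain ⟨a, A, hA, rfl⟩ := hα
  rwa [Nx_coset hA]

lemma IsExt.add_mem_of_mem_Nx {α : Set ℝ*} (hα : IsExt α) {x d : ℝ*} (hx : x ∈ α)
    (hd : d ∈ Nx α) : x + d ∈ α := by
  obtain ⟨a, A, hA, rfl⟩ := hα
  rw [Nx_coset hA] at hd
  obtain ⟨u, hu, rfl⟩ := hx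
  exact ⟨u + d, hA.add_mem hu hd, by ring⟩

lemma eabs_coset {A : Set ℝ*} (hA : IsNeutrix A) (a : ℝ*) :
    eabs (coset a A) = coset |a| A := by
  ext z
  constructor
  · rintro ⟨b, B, hB, h, u, hu, rfl⟩
    obtain ⟨rfl, w, hw, rfl⟩ := coset_eq_coset hA hB h
    refine ⟨(|a + w| - |a|) + u, hA.add_mem (hA.mem_of_abs_le hw ?_) hu, by ring⟩
    have h1 := abs_abs_sub_abs_le_abs_sub (a + w) a
    rwa [add_sub_cancel_left] at h1
  · rintro ⟨u, hu, rfl⟩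
    exact ⟨a, A, hA, rfl, u, hu, rfl⟩

lemma isNeutrix_mulPart {A B : Set ℝ*} (hA : IsNeutrix A) (hB : IsNeutrix B) (a b : ℝ*) :
    IsNeutrix (a • B + b • A + A * B) :=
  ((hB.smul a).add (hA.smul b)).add (hA.mul hB)

lemma emul_coset {A B : Set ℝ*} (hA : IsNeutrix A) (hB : IsNeutrix B) (a b : ℝ*) :
    emul (coset a A) (coset b B) = coset (a * b) (a • B + b • A + A * B) := by
  ext z
  constructor
  · rintro ⟨a', A', b', B', hA', hB', h1, h2, u, hu, v, hv, u', hu', v', hv', rfl⟩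
    obtain ⟨rfl, u₀, hu₀, rfl⟩ := coset_eq_coset hA hA' h1
    obtain ⟨rfl, v₀, hv₀, rfl⟩ := coset_eq_coset hB hB' h2
    have hm := hA.mul hB
    refine ⟨a * (v₀ + v) + b * (u₀ + u) + (u₀ * v₀ + u₀ * v + u * v₀ + u' * v'),
      Set.add_mem_add (Set.add_mem_add ⟨_, hB.add_mem hv₀ hv, rfl⟩ ⟨_, hA.add_mem hu₀ hu, rfl⟩)
        (hm.add_mem (hm.add_mem (hm.add_mem (Set.mul_mem_mul hu₀ hv₀) (Set.mul_mem_mul hu₀ hv))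
          (Set.mul_mem_mul hu hv₀)) (Set.mul_mem_mul hu' hv')), by ring⟩
  · rintro ⟨_, ⟨_, ⟨_, ⟨v, hv, rfl⟩, _, ⟨u, hu, rfl⟩, rfl⟩, _, ⟨u', hu', v', hv', rfl⟩, rfl⟩, rfl⟩
    exact ⟨a, A, b, B, hA, hB, rfl, rfl, u, hu, v, hv, u', hu', v', hv', by
      simp only [smul_eq_mul]; ring⟩

lemma IsExt.emul {α β : Set ℝ*} (hα : IsExt α) (hβ : IsExt β) : IsExt (emul α β) := by
  obtain ⟨a, A, hA, rfl⟩ := hα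
  obtain ⟨b, B, hB, rfl⟩ := hβ
  exact ⟨_, _, isNeutrix_mulPart hA hB a b, emul_coset hA hB a b⟩

lemma emul_comm (α β : Set ℝ*) : emul α β = emul β α := by
  have h : ∀ α β : Set ℝ*, emul α β ⊆ emul β α := by
    rintro α β _ ⟨a, A, b, B, hA, hB, h1, h2, u, hu, v, hv, u', hu', v', hv', rfl⟩
    exact ⟨b, B, a, A, hB, hA, h2, h1, v, hv, u, hu, v', hv', u', hu', by ring⟩
  exact (h α β).antisymm (h β α)

lemma isExt_singleton (a : ℝ*) : IsExt {a} :=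
  ⟨a, {0}, isNeutrix_singleton_zero, (coset_singleton_zero a).symm⟩

lemma isExt_eprod : ∀ {n : ℕ} (f : Fin n → Set ℝ*), (∀ i, IsExt (f i)) → IsExt (eprod f)
  | 0, _, _ => isExt_singleton 1
  | _ + 1, f, hf => (hf 0).emul (isExt_eprod (fun i => f i.succ) fun i => hf i.succ)

lemma epow_coset {A : Set ℝ*} (hA : IsNeutrix A) (a : ℝ*) (k : ℕ) :
    ∃ D, IsNeutrix D ∧ epow (coset a A) k = coset (a ^ k) D := by
  induction k with
  | zero => exact ⟨{0}, isNeutrix_singleton_zero, by rw [coset_singleton_zero, pow_zero]; rfl⟩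
  | succ k ih =>
    obtain ⟨D, hD, h⟩ := ih
    refine ⟨_, isNeutrix_mulPart hA hD a (a ^ k), ?_⟩
    rw [pow_succ', ← emul_coset hA hD, ← h]
    rfl

lemma smul_subset_emul_epow {A N : Set ℝ*} (hA : IsNeutrix A) (hN : IsNeutrix N) (a : ℝ*)
    (k : ℕ) : a ^ k • N ⊆ emul (epow (coset a A) k) N := by
  obtain ⟨D, hD, h⟩ := epow_coset hA a k
  rintro _ ⟨v, hv, rfl⟩
  exact ⟨a ^ k, D, 0, N, hD, hN, h, (coset_zero N).symm, 0, hD.zero_mem, v, hv, 0, hD.zero_mem,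
    0, hN.zero_mem, by simp⟩

lemma abs_le_of_coset_bounded {A : Set ℝ*} (hA : IsNeutrix A) {a c : ℝ*}
    (h : ∀ x ∈ coset a A, |x| ≤ c) : |a| ≤ c ∧ ∀ u ∈ A, |u| ≤ c := by
  refine ⟨h a (mem_coset_self hA a), fun u hu => ?_⟩
  have h1 := abs_le.1 (h (a + u) ⟨u, hu, rfl⟩)
  have h2 := abs_le.1 (h (a + -u) ⟨-u, hA.neg_mem hu, rfl⟩)
  exact abs_le.2 ⟨by linarith [h1.1, h2.2], by linarith [h1.2, h2.1]⟩

lemma abs_le_of_mem_emul {α β : Set ℝ*} {c d : ℝ*} (hα : ∀ x ∈ α, |x| ≤ c)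
    (hβ : ∀ x ∈ β, |x| ≤ d) : ∀ z ∈ emul α β, |z| ≤ 4 * c * d := by
  rintro _ ⟨a, A, b, B, hA, hB, rfl, rfl, u, hu, v, hv, u', hu', v', hv', rfl⟩
  obtain ⟨ha, hA'⟩ := abs_le_of_coset_bounded hA hα
  obtain ⟨hb, hB'⟩ := abs_le_of_coset_bounded hB hβ
  have hmul : ∀ {x y : ℝ*}, |x| ≤ c → |y| ≤ d → |x * y| ≤ c * d := fun {x y} hx hy => by
    rw [abs_mul]
    exact mul_le_mul hx hy (abs_nonneg y) ((abs_nonneg x).trans hx)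
  have h1 := abs_le.1 (hmul ha hb)
  have h2 := abs_le.1 (hmul ha (hB' v hv))
  have h3 := abs_le.1 (hmul (hA' u hu) hb)
  have h4 := abs_le.1 (hmul (hA' u' hu') (hB' v' hv'))
  exact abs_le.2 ⟨by linarith [h1.1, h2.1, h3.1, h4.1], by linarith [h1.2, h2.2, h3.2, h4.2]⟩

lemma emul_subset_smul {α β N : Set ℝ*} {c : ℝ*} (hN : IsNeutrix N)
    (hα : ∀ x ∈ α, |x| ≤ c) (hβ : β ⊆ N) : emul α β ⊆ c • N := by
  rintro _ ⟨a, A, b, B, hA, hB, rfl, rfl, u, hu, v, hv, u', hu', v', hv', rfl⟩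
  obtain ⟨ha, hA'⟩ := abs_le_of_coset_bounded hA hα
  have hb : b ∈ N := hβ (mem_coset_self hB b)
  have hB' : ∀ v ∈ B, v ∈ N := fun v hv => by
    have h := hN.sub_mem (hβ ⟨v, hv, rfl⟩) hb
    rwa [add_sub_cancel_left] at h
  have hS := hN.smul c
  have hmul : ∀ {x y : ℝ*}, |x| ≤ c → y ∈ N → x * y ∈ c • N := fun {x y} hx hy => by
    refine hS.mem_of_abs_le ⟨y, hy, rfl⟩ ?_
    simp only [smul_eq_mul]
    rw [abs_mul, abs_mul]
    exact mul_le_mul_of_nonneg_right (hx.trans (le_abs_self c)) (abs_nonneg y)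
  rw [mul_comm b u]
  exact hS.add_mem (hS.add_mem (hS.add_mem (hmul ha hb) (hmul ha (hB' v hv)))
    (hmul (hA' u hu) hb)) (hmul (hA' u' hu') (hB' v' hv'))

lemma abs_le_of_mem_eprod {c : ℝ*} : ∀ {n : ℕ} (f : Fin n → Set ℝ*),
    (∀ i, ∀ x ∈ f i, |x| ≤ c) → ∀ z ∈ eprod f, |z| ≤ (4 * c) ^ n
  | 0, _, _, z, hz => by
    rw [Set.mem_singleton_iff.1 hz]; simp
  | n + 1, f, hf, z, hz => by
    rw [pow_succ']
    exact abs_le_of_mem_emul (hf 0)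
      (abs_le_of_mem_eprod (fun i => f i.succ) fun i => hf i.succ) z hz

lemma eprod_subset_smul {c : ℝ*} {N : Set ℝ*} (hN : IsNeutrix N) :
    ∀ {n : ℕ} (f : Fin (n + 1) → Set ℝ*), (∀ i, ∀ x ∈ f i, |x| ≤ c) →
      (∃ i, f i ⊆ N) → eprod f ⊆ (4 * c) ^ n • N := by
  intro n
  induction n with
  | zero =>
    rintro f hf ⟨i, hi⟩
    obtain rfl : i = 0 := Fin.ext (by omega)
    refine (emul_comm (f 0) _).trans_subset (emul_subset_smul hN ?_ hi)
    exact abs_le_of_mem_eprod (fun i : Fin 0 => f i.succ) fun i => hf i.succ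
  | succ n ih =>
    rintro f hf ⟨i, hi⟩
    induction i using Fin.cases with
    | zero =>
      refine (emul_comm (f 0) _).trans_subset (emul_subset_smul hN ?_ hi)
      exact abs_le_of_mem_eprod (fun i => f i.succ) fun i => hf i.succ
    | succ j =>
      have h := ih (fun i => f i.succ) (fun i => hf i.succ) ⟨j, hi⟩
      have h0 : ∀ x ∈ f 0, |x| ≤ 4 * c := fun x hx => by
        linarith [hf 0 x hx, abs_nonneg x]
      rw [pow_succ', mul_smul]
      exact emul_subset_smul (hN.smul _) h0 h

lemma exists_lt_apply_of_ne_one {n : ℕ} {σ : Equiv.Perm (Fin n)} (hσ : σ ≠ 1) :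
    (∃ i : Fin n, (σ i : ℕ) < (i : ℕ)) ∧ ∃ i : Fin n, (i : ℕ) < (σ i : ℕ) := by
  have hsum : ∑ i, (σ i : ℕ) = ∑ i : Fin n, (i : ℕ) := Equiv.sum_comp σ fun i : Fin n => (i : ℕ)
  constructor
  · by_contra! h
    exact hσ (Equiv.ext fun i => Fin.ext
      ((Finset.sum_eq_sum_iff_of_le fun i _ => h i).1 hsum.symm i (Finset.mem_univ i)).symm)
  · by_contra! h
    exact hσ (Equiv.ext fun i => Fin.ext
      ((Finset.sum_eq_sum_iff_of_le fun i _ => h i).1 hsum i (Finset.mem_univ i)))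

lemma esmul_one (α : Set ℝ*) : esmul 1 α = α := by simp [esmul]

/-- The determinant of a triangular matrix is the product of its diagonal plus a sum of elements
of a neutrix controlled by the size of the entries and of their neutrix parts. -/
lemma exists_detE_eq_eprod_add {n : ℕ} (M : Matrix (Fin (n + 1)) (Fin (n + 1)) (Set ℝ*))
    (hM : ∀ i j, IsExt (M i j))
    (htri : (∀ i j : Fin (n + 1), (j : ℕ) < (i : ℕ) → IsNeutrix (M i j)) ∨
      ∀ i j : Fin (n + 1), (i : ℕ) < (j : ℕ) → IsNeutrix (M i j))
    {N : Set ℝ*} (hN : IsNeutrix N) (hNx : ∀ i j, Nx (M i j) ⊆ N) {c : ℝ*}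
    (hc : ∀ i j, ∀ x ∈ M i j, |x| ≤ c) :
    ∃ S : Set ℝ*, S.Nonempty ∧ S ⊆ (4 * c) ^ n • N ∧
      detE M = eprod (fun i => M i i) + S := by
  have hS := hN.smul ((4 * c) ^ n)
  refine ⟨∑ σ ∈ Finset.univ.erase (1 : Equiv.Perm (Fin (n + 1))),
    esmul ((Equiv.Perm.sign σ : ℤ) : ℝ*) (eprod fun i => M i (σ i)), ?_, ?_, ?_⟩
  · refine Finset.sum_induction _ Set.Nonempty (fun _ _ => Set.Nonempty.add) Set.zero_nonempty
      fun σ _ => ?_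
    exact (isExt_eprod _ fun i => hM i (σ i)).nonempty.image _
  · refine hS.finsetSum_subset _ _ fun σ hσ => ?_
    have hne := exists_lt_apply_of_ne_one (Finset.ne_of_mem_erase hσ)
    have hex : ∃ i, IsNeutrix (M i (σ i)) := by
      rcases htri with h | h
      · exact hne.1.imp fun i hi => h _ _ hi
      · exact hne.2.imp fun i hi => h _ _ hi
    have hsub : eprod (fun i => M i (σ i)) ⊆ (4 * c) ^ n • N := by
      refine eprod_subset_smul hN _ (fun i => hc i (σ i)) ?_
      obtain ⟨i, hi⟩ := hex
      exact ⟨i, fun x hx => hNx i (σ i) ⟨x, hx, 0, hi.zero_mem, by simp⟩⟩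
    rintro _ ⟨z, hz, rfl⟩
    rcases Int.units_eq_one_or (Equiv.Perm.sign σ) with h | h
    · simpa [h] using hsub hz
    · simpa [h] using hS.neg_mem (hsub hz)
  · rw [detE, ← Finset.add_sum_erase _ _ (Finset.mem_univ (1 : Equiv.Perm (Fin (n + 1))))]
    congr 1
    simp [esmul_one]

/-- Elements of an external number whose absolute value is bounded by a zeroless `a + N` with
`a ≥ 0` are at most `2a` in absolute value. -/
lemma abs_le_two_mul_of_ele {α N : Set ℝ*} {a : ℝ*} (hα : IsExt α) (hN : IsNeutrix N)
    (ha : 0 ≤ a) (hz : Zeroless (coset a N)) (h : ele (eabs α) (coset a N)) :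
    ∀ x ∈ α, |x| ≤ 2 * a := by
  obtain ⟨b, B, hB, rfl⟩ := hα
  rintro _ ⟨u, hu, rfl⟩
  rw [eabs_coset hB] at h
  obtain ⟨_, ⟨w, hw, rfl⟩, hle⟩ := h (|b| + |u|) ⟨|u|, hB.abs_mem hu, rfl⟩
  have hwa : w ≤ a := by
    by_contra! hlt
    have haN : a ∈ N := hN.mem_of_abs_le hw (abs_le_abs_of_nonneg ha hlt.le)
    exact hz ⟨-a, hN.neg_mem haN, by simp⟩
  linarith [abs_add_le b u]

lemma zeroless_coset_one {N : Set ℝ*} (hN : IsNeutrix N) (h : N ⊆ oslash) :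
    Zeroless (coset 1 N) := by
  rintro ⟨u, hu, h0⟩
  have h1 : (1 : ℝ*) ∈ oslash := by
    have h2 := h (hN.neg_mem hu)
    rwa [← eq_neg_of_add_eq_zero_left h0.symm] at h2
  have h3 : Hyperreal.IsSt (1 : ℝ*) (0 : ℝ) := h1
  have h4 := h3.unique (Hyperreal.isSt_refl_real 1)
  norm_num at h4

theorem stmt12 {n : ℕ} (A : Matrix (Fin n) (Fin n) (Set ℝ*))
    (hA : ∀ i j, IsExt (A i j))
    (htri : (∀ i j : Fin n, (j : ℕ) < (i : ℕ) → IsNeutrix (A i j)) ∨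
      ∀ i j : Fin n, (i : ℕ) < (j : ℕ) → IsNeutrix (A i j))
    (abar Abar : Set ℝ*)
    (habar1 : ∃ i j, abar = eabs (A i j)) (habar2 : ∀ i j, ele (eabs (A i j)) abar)
    (hzl : Zeroless abar)
    (hAbar1 : ∃ i j, Abar = Nx (A i j)) (hAbar2 : ∀ i j, Nx (A i j) ⊆ Abar) :
    (IsReducedMat A → detE A ⊆ eprod (fun i => A i i) + Abar) ∧
      detE A ⊆ eprod (fun i => A i i) + emul (epow abar (n - 1)) Abar ∧
      (emul (epow abar (n - 1)) Abar ⊆ Nx (eprod fun i => A i i) →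
        detE A = eprod fun i => A i i) := by
  obtain _ | n := n
  · obtain ⟨i, -⟩ := habar1
    exact i.elim0
  have hN : IsNeutrix Abar := by
    obtain ⟨i, j, rfl⟩ := hAbar1
    exact (hA i j).isNeutrix_Nx
  have hscale : ∀ a : ℝ*, (4 * (2 * a)) ^ n • Abar ⊆ a ^ n • Abar := by
    rintro a _ ⟨v, hv, rfl⟩
    refine ⟨((8 ^ n : ℕ) : ℝ*) * v, hN.natCast_mul_mem _ hv, ?_⟩
    simp only [smul_eq_mul]
    push_cast
    rw [← mul_assoc (4 : ℝ*), mul_pow]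
    norm_num
    ring
  obtain ⟨a, A₁, hA₁, ha, habar⟩ : ∃ a A₁, IsNeutrix A₁ ∧ 0 ≤ a ∧ abar = coset a A₁ := by
    obtain ⟨i, j, rfl⟩ := habar1
    obtain ⟨b, B, hB, h⟩ := hA i j
    exact ⟨|b|, B, hB, abs_nonneg b, by rw [h, eabs_coset hB]⟩
  obtain ⟨S, hSne, hS, hdet⟩ := exists_detE_eq_eprod_add A hA htri hN hAbar2
    fun i j => abs_le_two_mul_of_ele (hA i j) hA₁ ha (habar ▸ hzl) (habar ▸ habar2 i j)
  have hSN : S ⊆ emul (epow abar (n + 1 - 1)) Abar := by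
    rw [habar]
    exact (hS.trans (hscale a)).trans (smul_subset_emul_epow hA₁ hN a n)
  refine ⟨?_, ?_, fun hsub => ?_⟩
  · rintro ⟨A₀, hA₀, hinf, -, hle⟩
    obtain ⟨T, -, hT, hdet'⟩ := exists_detE_eq_eprod_add A hA htri hN hAbar2
      fun i j => abs_le_two_mul_of_ele (hA i j) hA₀ zero_le_one (zeroless_coset_one hA₀ hinf)
        (hle i j)
    rw [hdet']
    refine Set.add_subset_add_left (hT.trans ?_)
    simpa using hscale 1
  · rw [hdet]
    exact Set.add_subset_add_left hSN
  · have hP := isExt_eprod (fun i => A i i) fun i => hA i i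
    rw [hdet]
    apply Set.Subset.antisymm
    · rintro _ ⟨p, hp, s, hs, rfl⟩
      exact hP.add_mem_of_mem_Nx hp (hsub (hSN hs))
    · intro p hp
      obtain ⟨s, hs⟩ := hSne
      exact ⟨p + -s, hP.add_mem_of_mem_Nx hp (hP.isNeutrix_Nx.neg_mem (hsub (hSN hs))), s, hs,
        by simp⟩
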